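/- Let X be an n-dimensional variety over an algebraically closed field that is locally a complete intersection, and m ≥ 1. Then X_m is pure dimensional if and only if dim X_m ≤ n(m+1); and in that case X_m is again locally a complete intersection. Moreover, X_m is irreducible if and only if dim π_m^{-1}(X_sing) < n(m+1). -/

import Mathlib

noncomputable section

/-- The universal substitution `U_i ↦ ∑_j X_{i,j} t^j` computing the equations of jet schemes:
a polynomial `f` in the variables `σ` is sent to a polynomial in `t` whose coefficients are the
equations of the jet scheme of `V(f)`. -/
def jetSub (k : Type*) [CommRing k] (σ : Type*) (m : ℕ) :
    MvPolynomial σ k →ₐ[k] Polynomial (MvPolynomial (σ × Fin (m + 1)) k) :=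
  MvPolynomial.aeval fun i =>
    ∑ j : Fin (m + 1), Polynomial.C (MvPolynomial.X (i, j)) * Polynomial.X ^ (j : ℕ)

/-- The ideal of the `m`-th jet scheme of the closed subscheme of affine space `Spec k[σ]`
defined by the equations in `F`: it is generated by the coefficients of `t^l`, `0 ≤ l ≤ m`,
of the universal substitutions of the elements of `F`. -/
def jetIdeal (k : Type*) [CommRing k] (σ : Type*) (m : ℕ)
    (F : Set (MvPolynomial σ k)) : Ideal (MvPolynomial (σ × Fin (m + 1)) k) :=
  Ideal.span {g | ∃ f ∈ F, ∃ l ≤ m, g = Polynomial.coeff (jetSub k σ m f) l}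

/-- The ideal of the fiber `π_m⁻¹(x)` of the `m`-th jet scheme over the point `x`. -/
def jetFiberIdeal (k : Type*) [CommRing k] (σ : Type*) (m : ℕ)
    (F : Set (MvPolynomial σ k)) (x : σ → k) : Ideal (MvPolynomial (σ × Fin (m + 1)) k) :=
  jetIdeal k σ m F ⊔
    Ideal.span (Set.range fun i : σ =>
      MvPolynomial.X (i, (0 : Fin (m + 1))) - MvPolynomial.C (x i))

/-- The ideal of the locus `π_m⁻¹(Z)` of `m`-jets lying over the closed subscheme `Z = V(G)`. -/
def jetOverIdeal (k : Type*) [CommRing k] (σ : Type*) (m : ℕ)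
    (F G : Set (MvPolynomial σ k)) : Ideal (MvPolynomial (σ × Fin (m + 1)) k) :=
  jetIdeal k σ m F ⊔
    Ideal.span ((MvPolynomial.rename fun i : σ => (i, (0 : Fin (m + 1)))) '' G)

/-- The Zariski tangent space at a point `x` of the subvariety of affine space cut out by the
equations `F`, namely the common kernel of the differentials at `x`. -/
def tangentSpaceAt (k : Type*) [Field k] {σ : Type*} [Fintype σ]
    (F : Set (MvPolynomial σ k)) (x : σ → k) : Submodule k (σ → k) :=
  ⨅ f ∈ F, LinearMap.ker (∑ i : σ,
    MvPolynomial.eval x (MvPolynomial.pderiv i f) •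
      (LinearMap.proj i : (σ → k) →ₗ[k] k))

/-- Equations of the singular locus of the l.c.i. variety `V(F) ⊆ 𝔸^N` cut out by the
`r = N - n` equations `F`: the equations themselves together with all `r × r` minors of the
Jacobian matrix. -/
def lciSingEquations (k : Type*) [CommRing k] {N r : ℕ}
    (F : Fin r → MvPolynomial (Fin N) k) : Set (MvPolynomial (Fin N) k) :=
  Set.range F ∪
    {g | ∃ c : Fin r → Fin N,
      g = Matrix.det (Matrix.of fun α β : Fin r => MvPolynomial.pderiv (c β) (F α))}

theorem Ideal.height_eq_card_of_isMaximal_mvPolynomial {k : Type*} [Field k] {σ : Type*} [Finite σ]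
    (M : Ideal (MvPolynomial σ k)) [M.IsMaximal] : M.height = Nat.card σ := by
  suffices H : ∀ n : ℕ, ∀ M : Ideal (MvPolynomial (Fin n) k), M.IsMaximal → M.height = n by
    let e := (MvPolynomial.renameEquiv k (Finite.equivFin σ)).toRingEquiv
    have : (M.map e).IsMaximal := Ideal.map_isMaximal_of_equiv e
    rw [← e.height_map, H _ _ this]
  intro n
  induction n with
  | zero =>
    intro M hM
    have : M.height ≤ ringKrullDim (MvPolynomial (Fin 0) k) :=
      Ideal.height_le_ringKrullDim_of_isPrime
    simp at this
    simpa using this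
  | succ n ih =>
    intro M hM
    let e := (MvPolynomial.finSuccEquiv k n).toRingEquiv
    have hM' : (M.map e).IsMaximal := Ideal.map_isMaximal_of_equiv e
    have h1 : ((M.map e).under (MvPolynomial (Fin n) k)).IsMaximal :=
      Polynomial.isMaximal_comap_C_of_isJacobsonRing _
    have : (M.map e).LiesOver ((M.map e).under (MvPolynomial (Fin n) k)) := ⟨rfl⟩
    rw [← e.height_map,
      Polynomial.height_eq_height_add_one ((M.map e).under (MvPolynomial (Fin n) k)), ih _ h1]
    simp

theorem ringKrullDim_quotient_le_of_forall_minimalPrimes {R : Type*} [CommRing R] (J : Ideal R)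
    (d : WithBot ℕ∞) (h : ∀ p ∈ J.minimalPrimes, ringKrullDim (R ⧸ p) ≤ d) :
    ringKrullDim (R ⧸ J) ≤ d := by
  rw [ringKrullDim_quotient]
  refine iSup_le fun s => ?_
  have hJ : J ≤ s.head.1.asIdeal := s.head.2
  obtain ⟨p, hp, hps⟩ := Ideal.exists_minimalPrimes_le hJ
  refine le_trans ?_ (h p hp)
  rw [ringKrullDim_quotient]
  have hs : ∀ i, p ≤ (s i).1.asIdeal := fun i => hps.trans (s.head_le i)
  let t : LTSeries (PrimeSpectrum.zeroLocus (R := R) (p : Set R)) :=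
    { length := s.length
      toFun := fun i => ⟨(s i).1, hs i⟩
      step := fun i => s.step i }
  exact Order.LTSeries.length_le_krullDim t

theorem ringKrullDim_quotient_mono {R : Type*} [CommRing R] {I J : Ideal R} (h : I ≤ J) :
    ringKrullDim (R ⧸ J) ≤ ringKrullDim (R ⧸ I) :=
  ringKrullDim_le_of_surjective (Ideal.Quotient.factor h) (Ideal.Quotient.factor_surjective h)

theorem Ideal.exists_isMaximal_notMem {R : Type*} [CommRing R] [IsJacobsonRing R] (p : Ideal R)
    [hp : p.IsPrime] {f : R} (hf : f ∉ p) : ∃ M : Ideal R, M.IsMaximal ∧ p ≤ M ∧ f ∉ M := by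
  by_contra! H
  apply hf
  rw [← hp.radical, Ideal.radical_eq_jacobson, Ideal.jacobson, Ideal.mem_sInf]
  intro M hM
  exact H M hM.2 hM.1

theorem Ideal.exists_mem_minimalPrimes_notMem {R : Type*} [CommRing R] [IsNoetherianRing R]
    {J p : Ideal R} (hp : p ∈ J.minimalPrimes) :
    ∃ f ∉ p, ∀ q ∈ J.minimalPrimes, q ≠ p → f ∈ q := by
  have hfin := J.finite_minimalPrimes_of_isNoetherianRing
  have hpp : p.IsPrime := hp.1.1
  have h1 : ∀ q ∈ J.minimalPrimes, ∃ f ∉ p, (q ≠ p → f ∈ q) := by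
    intro q hq
    by_cases hqp : q = p
    · exact ⟨1, (Ideal.ne_top_iff_one p).1 hpp.ne_top, fun h => (h hqp).elim⟩
    · have : ¬ q ≤ p := fun h => hqp (le_antisymm h (hp.2 hq.1 h))
      obtain ⟨f, hf, hfp⟩ := SetLike.not_le_iff_exists.1 this
      exact ⟨f, hfp, fun _ => hf⟩
  choose! f hf hfq using h1
  refine ⟨∏ q ∈ hfin.toFinset, f q, ?_, ?_⟩
  · rw [hpp.prod_mem_iff]
    rintro ⟨q, hq, h⟩
    exact hf q (hfin.mem_toFinset.1 hq) h
  · intro q hq hqp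
    exact Ideal.prod_mem _ (hfin.mem_toFinset.2 hq) (hfq q hq hqp)

theorem natCard_le_ringKrullDim_quotient_add_of_mem_minimalPrimes {k : Type*} [Field k]
    {σ : Type*} [Finite σ] {J p : Ideal (MvPolynomial σ k)} (hp : p ∈ J.minimalPrimes) :
    (Nat.card σ : WithBot ℕ∞) ≤ ringKrullDim (MvPolynomial σ k ⧸ p) + J.spanFinrank := by
  have hpp : p.IsPrime := hp.1.1
  obtain ⟨f, hf, hfq⟩ := Ideal.exists_mem_minimalPrimes_notMem hp
  obtain ⟨M, hM, hpM, hfM⟩ := p.exists_isMaximal_notMem hf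
  have hJM : J ≤ M := hp.1.2.trans hpM
  have h1 := Ideal.height_le_height_add_spanFinrank_of_le hJM
  rw [Ideal.height_eq_card_of_isMaximal_mvPolynomial] at h1
  have hMJ : (M.map (Ideal.Quotient.mk J)).IsPrime := Ideal.isPrime_map_quotientMk_of_isPrime hJM
  have hcomap : (M.map (Ideal.Quotient.mk J)).comap (Ideal.Quotient.mk J) = M := by
    rw [Ideal.comap_map_of_surjective' _ Ideal.Quotient.mk_surjective, Ideal.mk_ker]
    exact sup_eq_left.2 hJM
  have h2 : ((M.map (Ideal.Quotient.mk J)).height : WithBot ℕ∞) ≤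
      ringKrullDim (MvPolynomial σ k ⧸ p) := by
    obtain ⟨l, hl, hlen⟩ := Ideal.exists_ltSeries_length_eq_height (M.map (Ideal.Quotient.mk J))
    rw [← hlen, ringKrullDim_quotient]
    have hpl : ∀ i, p ≤ (PrimeSpectrum.comap (Ideal.Quotient.mk J) (l i)).asIdeal := by
      intro i
      have hJl : J ≤ (PrimeSpectrum.comap (Ideal.Quotient.mk J) (l i)).asIdeal := by
        rw [PrimeSpectrum.comap_asIdeal]
        conv_lhs => rw [← Ideal.mk_ker (I := J)]
        exact Ideal.comap_mono bot_le
      have hlM : (PrimeSpectrum.comap (Ideal.Quotient.mk J) (l i)).asIdeal ≤ M := by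
        conv_rhs => rw [← hcomap]
        have h3 : l i ≤ l.last := LTSeries.monotone l (Fin.le_last i)
        rw [hl] at h3
        exact Ideal.comap_mono h3
      obtain ⟨q, hq, hql⟩ := Ideal.exists_minimalPrimes_le hJl
      by_cases hqp : q = p
      · exact hqp ▸ hql
      · exact (hfM (hlM (hql (hfq q hq hqp)))).elim
    let t : LTSeries (PrimeSpectrum.zeroLocus (R := MvPolynomial σ k) (p : Set _)) :=
      { length := l.length
        toFun := fun i => ⟨PrimeSpectrum.comap (Ideal.Quotient.mk J) (l i), hpl i⟩
        step := fun i => (Ideal.orderEmbeddingOfSurjective (Ideal.Quotient.mk J)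
          Ideal.Quotient.mk_surjective).strictMono (l.step i) }
    exact Order.LTSeries.length_le_krullDim t
  calc (Nat.card σ : WithBot ℕ∞) = ((Nat.card σ : ℕ∞) : WithBot ℕ∞) := by norm_cast
    _ ≤ (((M.map (Ideal.Quotient.mk J)).height + J.spanFinrank : ℕ∞) : WithBot ℕ∞) := by
      exact_mod_cast h1
    _ ≤ _ := by
      push_cast
      gcongr

theorem ringKrullDim_le_of_isIntegral {R S : Type*} [CommRing R] [CommRing S] [Algebra R S]
    [Algebra.IsIntegral R S] : ringKrullDim S ≤ ringKrullDim R :=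
  Order.krullDim_le_of_strictMono (PrimeSpectrum.comap (algebraMap R S)) fun _ _ h =>
    Ideal.IsIntegral.comap_lt_comap (R := R) h

theorem ringKrullDim_le_of_isIntegral_of_injective {R S : Type*} [CommRing R] [CommRing S]
    [Algebra R S] [Algebra.IsIntegral R S] [FaithfulSMul R S] :
    ringKrullDim R ≤ ringKrullDim S := by
  refine iSup_le fun l => ?_
  obtain ⟨Q, _, hQ, hQl⟩ := Ideal.exists_ideal_over_prime_of_isIntegral (S := S)
    l.head.asIdeal ⊥ (by
      rw [← RingHom.ker_eq_comap_bot, (RingHom.injective_iff_ker_eq_bot _).1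
        (FaithfulSMul.algebraMap_injective R S)]
      exact bot_le)
  have : Q.LiesOver l.head.asIdeal := ⟨hQl.symm⟩
  obtain ⟨L, hL, -⟩ := Ideal.exists_ltSeries_of_hasGoingUp l Q
  rw [← hL]
  exact Order.LTSeries.length_le_krullDim L

theorem exists_natCast_eq_ringKrullDim_and_trdeg (k : Type*) [Field k] {C : Type*} [CommRing C]
    [IsDomain C] [Algebra k C] [Algebra.FiniteType k C] :
    ∃ s : ℕ, ringKrullDim C = s ∧ Algebra.trdeg k C = s := by
  obtain ⟨s, g, hg, hgint⟩ := exists_integral_inj_algHom_of_fg k C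
  refine ⟨s, ?_, ?_⟩
  · algebraize [g.toRingHom]
    have : FaithfulSMul (MvPolynomial (Fin s) k) C :=
      (faithfulSMul_iff_algebraMap_injective _ _).2 hg
    have : Algebra.IsIntegral (MvPolynomial (Fin s) k) C := ⟨hgint⟩
    rw [le_antisymm (ringKrullDim_le_of_isIntegral (R := MvPolynomial (Fin s) k) (S := C))
      ringKrullDim_le_of_isIntegral_of_injective]
    simp
  · algebraize [g.toRingHom]
    have : FaithfulSMul (MvPolynomial (Fin s) k) C :=
      (faithfulSMul_iff_algebraMap_injective _ _).2 hg
    have : Algebra.IsIntegral (MvPolynomial (Fin s) k) C := ⟨hgint⟩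
    have : Algebra.IsAlgebraic (MvPolynomial (Fin s) k) C := Algebra.IsIntegral.isAlgebraic
    have := lift_trdeg_add_eq k (MvPolynomial (Fin s) k) C
    rw [MvPolynomial.trdeg_of_isDomain,
      trdeg_eq_zero (R := MvPolynomial (Fin s) k) (A := C)] at this
    simp only [Cardinal.mk_fintype, Fintype.card_fin, Cardinal.lift_natCast, Cardinal.lift_zero,
      add_zero] at this
    exact (Cardinal.lift_eq_nat_iff.1 this.symm)

theorem MvPolynomial.coeff_zero_aeval {k : Type*} [CommRing k] {σ : Type*} {Q : Type*} [CommRing Q]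
    [Algebra k Q] (P : σ → Polynomial Q) (f : MvPolynomial σ k) :
    (aeval P f).coeff 0 = aeval (fun i => (P i).coeff 0) f := by
  have := MvPolynomial.map_aeval P (Polynomial.constantCoeff (R := Q)) f
  simp only [Polynomial.constantCoeff_apply] at this
  rw [this, MvPolynomial.aeval_def, MvPolynomial.coe_eval₂Hom]
  congr 1
  ext x
  simp

/-- First order Taylor expansion of a polynomial along two arcs congruent modulo `t ^ l`. -/
theorem MvPolynomial.aeval_sub_aeval_of_X_pow_dvd {k : Type*} [CommRing k] {σ : Type*} [Fintype σ]
    {Q : Type*} [CommRing Q] [Algebra k Q] {l : ℕ} (hl : l ≠ 0) {P P' : σ → Polynomial Q}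
    (h : ∀ i, Polynomial.X ^ l ∣ P' i - P i) (f : MvPolynomial σ k) :
    Polynomial.X ^ l ∣ aeval P' f - aeval P f ∧
    (aeval P' f - aeval P f).coeff l =
      ∑ i, aeval (fun i => (P i).coeff 0) (pderiv i f) * (P' i - P i).coeff l := by
  classical
  have hmul : ∀ (a b : Polynomial Q), Polynomial.X ^ l ∣ a →
      (a * b).coeff l = a.coeff l * b.coeff 0 := by
    rintro _ b ⟨a, rfl⟩
    rw [mul_assoc]
    simp [Polynomial.coeff_X_pow_mul', Polynomial.mul_coeff_zero]
  induction f using MvPolynomial.induction_on with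
  | C a => simp
  | add f g hf hg =>
    constructor
    · have : aeval P' (f + g) - aeval P (f + g) =
          (aeval P' f - aeval P f) + (aeval P' g - aeval P g) := by simp; ring
      rw [this]
      exact dvd_add hf.1 hg.1
    · have : aeval P' (f + g) - aeval P (f + g) =
          (aeval P' f - aeval P f) + (aeval P' g - aeval P g) := by simp; ring
      rw [this, Polynomial.coeff_add, hf.2, hg.2, ← Finset.sum_add_distrib]
      refine Finset.sum_congr rfl fun i _ => ?_
      rw [map_add, map_add]
      ring
  | mul_X f j hf =>
    have e : aeval P' (f * MvPolynomial.X j) - aeval P (f * MvPolynomial.X j) =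
        (aeval P' f - aeval P f) * P' j + (P' j - P j) * aeval P f := by simp; ring
    have hj : (P' j).coeff 0 = (P j).coeff 0 := by
      rw [← sub_eq_zero, ← Polynomial.coeff_sub]
      exact Polynomial.X_pow_dvd_iff.1 (h j) 0 (Nat.pos_of_ne_zero hl)
    rw [e]
    refine ⟨dvd_add (hf.1.mul_right _) ((h j).mul_right _), ?_⟩
    rw [Polynomial.coeff_add, hmul _ _ hf.1, hmul _ _ (h j), hf.2,
      MvPolynomial.coeff_zero_aeval, hj, Finset.sum_mul]
    simp only [Derivation.leibniz, pderiv_X, map_add, smul_eq_mul, add_mul,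
      Finset.sum_add_distrib]
    rw [add_comm]
    congr 1
    · simp [Pi.single_apply, mul_comm, apply_ite]
    · refine Finset.sum_congr rfl fun i _ => ?_
      simp
      ring

open Polynomial in
/-- The polynomial arc with the given coordinates. -/
def jetArc {Q : Type*} [CommRing Q] {σ : Type*} {m : ℕ} (γ : σ × Fin (m + 1) → Q) (i : σ) :
    Q[X] :=
  ∑ j : Fin (m + 1), C (γ (i, j)) * X ^ (j : ℕ)

theorem jetArc_coeff {Q : Type*} [CommRing Q] {σ : Type*} {m : ℕ} (γ : σ × Fin (m + 1) → Q)
    (i : σ) (j : Fin (m + 1)) : (jetArc γ i).coeff j = γ (i, j) := by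
  simp [jetArc, Polynomial.finsetSum_coeff, Polynomial.coeff_C_mul, Polynomial.coeff_X_pow,
    Fin.val_inj]

theorem aeval_coeff_jetSub {k : Type*} [CommRing k] {σ : Type*} {m : ℕ} {Q : Type*} [CommRing Q]
    [Algebra k Q] (γ : σ × Fin (m + 1) → Q) (f : MvPolynomial σ k) (l : ℕ) :
    MvPolynomial.aeval γ ((jetSub k σ m f).coeff l) =
      (MvPolynomial.aeval (jetArc γ) f).coeff l := by
  have : (Polynomial.mapAlgHom (MvPolynomial.aeval γ)).comp (jetSub k σ m) =
      MvPolynomial.aeval (R := k) (jetArc γ) := by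
    ext i : 1
    simp [jetSub, jetArc, Polynomial.map_sum]
  rw [← this]
  simp [Polynomial.coeff_map]

theorem jetIdeal_le_ker_aeval_iff {k : Type*} [CommRing k] {σ : Type*} {m : ℕ} {Q : Type*}
    [CommRing Q] [Algebra k Q] (γ : σ × Fin (m + 1) → Q) (F : Set (MvPolynomial σ k)) :
    jetIdeal k σ m F ≤ RingHom.ker (MvPolynomial.aeval (R := k) γ) ↔
      ∀ f ∈ F, ∀ l ≤ m, (MvPolynomial.aeval (jetArc γ) f).coeff l = 0 := by
  rw [jetIdeal, Ideal.span_le]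
  constructor
  · intro h f hf l hl
    rw [← aeval_coeff_jetSub]
    exact h ⟨f, hf, l, hl, rfl⟩
  · rintro h _ ⟨f, hf, l, hl, rfl⟩
    rw [SetLike.mem_coe, RingHom.mem_ker, aeval_coeff_jetSub]
    exact h f hf l hl

/-- The submatrix of the Jacobian matrix of `F` on the columns `c`. -/
def jacobianMinor {k : Type*} [CommRing k] {σ : Type*} {r : ℕ} (F : Fin r → MvPolynomial σ k)
    (c : Fin r → σ) : Matrix (Fin r) (Fin r) (MvPolynomial σ k) :=
  Matrix.of fun α β => MvPolynomial.pderiv (c β) (F α)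

theorem jacobianMinor_injective {k : Type*} [CommRing k] {σ : Type*} {r : ℕ}
    {F : Fin r → MvPolynomial σ k} {c : Fin r → σ} (h : (jacobianMinor F c).det ≠ 0) :
    Function.Injective c := by
  intro a b hab
  by_contra hne
  exact h (Matrix.det_zero_of_column_eq hne fun i => by simp [jacobianMinor, hab])

theorem sum_pderiv_mul_eq_mulVec {k : Type*} [CommRing k] {σ : Type*} [Fintype σ] {r : ℕ}
    {Q : Type*} [CommRing Q] [Algebra k Q] (F : Fin r → MvPolynomial σ k) {c : Fin r → σ}
    (hc : Function.Injective c) (x : σ → Q) (δ : σ → Q) (hδ : ∀ i ∉ Set.range c, δ i = 0)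
    (α : Fin r) :
    ∑ i, MvPolynomial.aeval x (MvPolynomial.pderiv i (F α)) * δ i =
      ((jacobianMinor F c).map (MvPolynomial.aeval x)).mulVec (δ ∘ c) α := by
  classical
  simp only [Matrix.mulVec, dotProduct, Function.comp, Matrix.map_apply, jacobianMinor,
    Matrix.of_apply]
  rw [← Finset.sum_image (s := Finset.univ) (g := c)
    (f := fun i => MvPolynomial.aeval x (MvPolynomial.pderiv i (F α)) * δ i) (hc.injOn)]
  refine (Finset.sum_subset (Finset.subset_univ _) fun i _ hi => ?_).symm
  rw [hδ i (by simpa using hi), mul_zero]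

theorem jet_eq_of_jacobianMinor_ne_zero {k : Type*} [CommRing k] {σ : Type*} [Fintype σ] {r m : ℕ}
    {Q : Type*} [CommRing Q] [IsDomain Q] [Algebra k Q] {F : Fin r → MvPolynomial σ k}
    {c : Fin r → σ} (hc : Function.Injective c) {γ γ' : σ × Fin (m + 1) → Q}
    (hγ : ∀ α, ∀ l ≤ m, (MvPolynomial.aeval (jetArc γ) (F α)).coeff l = 0)
    (hγ' : ∀ α, ∀ l ≤ m, (MvPolynomial.aeval (jetArc γ') (F α)).coeff l = 0)
    (hdet : MvPolynomial.aeval (fun i => γ (i, 0)) (jacobianMinor F c).det ≠ 0)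
    (h0 : ∀ i, γ' (i, 0) = γ (i, 0)) (hfree : ∀ i ∉ Set.range c, ∀ j, γ' (i, j) = γ (i, j)) :
    γ' = γ := by
  suffices H : ∀ l (hl : l < m + 1) i, γ' (i, ⟨l, hl⟩) = γ (i, ⟨l, hl⟩) by
    ext ⟨i, j⟩
    exact H j j.2 i
  intro l
  induction l using Nat.strong_induction_on with
  | _ l ih =>
  intro hl
  obtain rfl | hl0 := Nat.eq_zero_or_pos l
  · exact h0
  have hdvd : ∀ i, Polynomial.X ^ l ∣ jetArc γ' i - jetArc γ i := by
    intro i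
    rw [Polynomial.X_pow_dvd_iff]
    intro d hd
    rw [Polynomial.coeff_sub]
    have h1 := jetArc_coeff γ i ⟨d, hd.trans hl⟩
    have h2 := jetArc_coeff γ' i ⟨d, hd.trans hl⟩
    simp only at h1 h2
    rw [h1, h2, ih d hd, sub_self]
  have hx : (fun i => (jetArc γ i).coeff 0) = fun i => γ (i, 0) :=
    funext fun i => jetArc_coeff γ i 0
  have hδ : ∀ i, (jetArc γ' i - jetArc γ i).coeff l = γ' (i, ⟨l, hl⟩) - γ (i, ⟨l, hl⟩) := by
    intro i
    have h1 := jetArc_coeff γ i ⟨l, hl⟩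
    have h2 := jetArc_coeff γ' i ⟨l, hl⟩
    rw [Polynomial.coeff_sub, ← h1, ← h2]
  set δ : σ → Q := fun i => γ' (i, ⟨l, hl⟩) - γ (i, ⟨l, hl⟩) with hδdef
  have hδ0 : ∀ i ∉ Set.range c, δ i = 0 := fun i hi => by simp [hδdef, hfree i hi]
  have hmul : ((jacobianMinor F c).map (MvPolynomial.aeval fun i => γ (i, 0))).mulVec (δ ∘ c)
      = 0 := by
    ext α
    rw [← sum_pderiv_mul_eq_mulVec F hc _ δ hδ0, Pi.zero_apply]
    have := (MvPolynomial.aeval_sub_aeval_of_X_pow_dvd hl0.ne' hdvd (F α)).2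
    rw [Polynomial.coeff_sub, hγ α l (Nat.lt_succ_iff.1 hl), hγ' α l (Nat.lt_succ_iff.1 hl),
      sub_zero, hx] at this
    rw [this]
    exact Finset.sum_congr rfl fun i _ => by rw [hδ]
  have hdet' : ((jacobianMinor F c).map (MvPolynomial.aeval fun i => γ (i, 0))).det ≠ 0 := by
    rw [← AlgHom.mapMatrix_apply, ← AlgHom.map_det]
    exact hdet
  have hz := Matrix.eq_zero_of_mulVec_eq_zero hdet' hmul
  intro i
  by_cases hi : i ∈ Set.range c
  · obtain ⟨β, rfl⟩ := hi
    exact sub_eq_zero.1 (congrFun hz β)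
  · exact hfree i hi _

theorem exists_arc_of_isUnit_jacobianMinor {k : Type*} [CommRing k] {σ : Type*} [Fintype σ] {r : ℕ}
    {Q : Type*} [CommRing Q] [Algebra k Q] {F : Fin r → MvPolynomial σ k}
    {c : Fin r → σ} (hc : Function.Injective c) (y : σ → ℕ → Q)
    (hF : ∀ α, MvPolynomial.aeval (fun i => y i 0) (F α) = 0)
    (hdet : IsUnit (MvPolynomial.aeval (fun i => y i 0) (jacobianMinor F c).det)) (m : ℕ) :
    ∃ P : σ → Polynomial Q, (∀ i, (P i).coeff 0 = y i 0) ∧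
      (∀ i ∉ Set.range c, ∀ l ≤ m, (P i).coeff l = y i l) ∧
      ∀ α, ∀ l ≤ m, (MvPolynomial.aeval P (F α)).coeff l = 0 := by
  classical
  induction m with
  | zero =>
    refine ⟨fun i => Polynomial.C (y i 0), by simp, by simp, ?_⟩
    intro α l hl
    obtain rfl : l = 0 := by omega
    rw [MvPolynomial.coeff_zero_aeval, ← hF α]
    simp only [Polynomial.coeff_C_zero]
  | succ m ih =>
    obtain ⟨P, hP0, hPy, hPF⟩ := ih
    set A := (jacobianMinor F c).map (MvPolynomial.aeval fun i => y i 0) with hA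
    have hAu : IsUnit A.det := by
      rw [hA, ← AlgHom.mapMatrix_apply, ← AlgHom.map_det]
      exact hdet
    let ε : σ → Q := fun i => if i ∈ Set.range c then 0 else y i (m + 1) - (P i).coeff (m + 1)
    let b : Fin r → Q := fun α => -(MvPolynomial.aeval P (F α)).coeff (m + 1) -
      ∑ i, MvPolynomial.aeval (fun i => y i 0) (MvPolynomial.pderiv i (F α)) * ε i
    let δ : σ → Q := Function.extend c (A⁻¹.mulVec b) 0
    have hδ0 : ∀ i ∉ Set.range c, δ i = 0 := fun i hi => by
      simp [δ, Function.extend_apply' _ _ _ hi]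
    have hδc : δ ∘ c = A⁻¹.mulVec b := by
      ext β
      simp [δ, hc.extend_apply]
    let P' : σ → Polynomial Q := fun i => P i + Polynomial.C (ε i + δ i) * Polynomial.X ^ (m + 1)
    have hsub : ∀ i, P' i - P i = Polynomial.C (ε i + δ i) * Polynomial.X ^ (m + 1) := by
      intro i
      simp [P']
    have hdvd : ∀ i, Polynomial.X ^ (m + 1) ∣ P' i - P i := by
      intro i
      rw [hsub]
      exact dvd_mul_left _ _
    have hlow : ∀ i, ∀ l ≤ m, (P' i).coeff l = (P i).coeff l := by
      intro i l hl
      have : l ≠ m + 1 := by omega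
      simp only [P', Polynomial.coeff_add, Polynomial.coeff_C_mul, Polynomial.coeff_X_pow,
        if_neg this, mul_zero, add_zero]
    refine ⟨P', fun i => by rw [hlow i 0 (Nat.zero_le _), hP0], ?_, ?_⟩
    · intro i hi l hl
      obtain hl | rfl := Nat.le_succ_iff.1 hl
      · rw [hlow i l hl, hPy i hi l hl]
      · have hε : ε i = y i (m + 1) - (P i).coeff (m + 1) := if_neg hi
        simp only [P', hδ0 i hi, hε, Polynomial.coeff_add, Polynomial.coeff_C_mul,
          Polynomial.coeff_X_pow, Nat.succ_eq_add_one, if_true]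
        ring
    · intro α l hl
      have ht := MvPolynomial.aeval_sub_aeval_of_X_pow_dvd (Nat.succ_ne_zero m) hdvd (F α)
      obtain hl | rfl := Nat.le_succ_iff.1 hl
      · have := Polynomial.X_pow_dvd_iff.1 ht.1 l (Nat.lt_succ_iff.2 hl)
        rw [Polynomial.coeff_sub, hPF α l hl, sub_zero] at this
        exact this
      · have h2 := ht.2
        have hx : (fun i => (P i).coeff 0) = fun i => y i 0 := funext hP0
        have hs := sum_pderiv_mul_eq_mulVec F hc (fun i => y i 0) δ hδ0 α
        rw [hδc, ← hA, Matrix.mulVec_mulVec, Matrix.mul_nonsing_inv _ hAu, Matrix.one_mulVec] at hs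
        simp only [hsub, hx, Polynomial.coeff_C_mul, Polynomial.coeff_X_pow, Polynomial.coeff_sub,
          if_true, mul_one, mul_add, Finset.sum_add_distrib, hs, b] at h2
        linear_combination h2

theorem exists_jet_of_isUnit_jacobianMinor {k : Type*} [CommRing k] {σ : Type*} [Fintype σ]
    {r m : ℕ} {Q : Type*} [CommRing Q] [Algebra k Q] {F : Fin r → MvPolynomial σ k}
    {c : Fin r → σ} (hc : Function.Injective c) (y : σ × Fin (m + 1) → Q)
    (hF : ∀ α, MvPolynomial.aeval (fun i => y (i, 0)) (F α) = 0)
    (hdet : IsUnit (MvPolynomial.aeval (fun i => y (i, 0)) (jacobianMinor F c).det)) :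
    ∃ γ : σ × Fin (m + 1) → Q, (∀ i, γ (i, 0) = y (i, 0)) ∧
      (∀ i ∉ Set.range c, ∀ j, γ (i, j) = y (i, j)) ∧
      ∀ α, ∀ l ≤ m, (MvPolynomial.aeval (jetArc γ) (F α)).coeff l = 0 := by
  obtain ⟨P, hP0, hPy, hPF⟩ := exists_arc_of_isUnit_jacobianMinor hc
    (fun i j => if h : j < m + 1 then y (i, ⟨j, h⟩) else 0) (by simpa using hF)
    (by simpa using hdet) m
  refine ⟨fun p => (P p.1).coeff p.2, fun i => by simpa using hP0 i, ?_, ?_⟩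
  · intro i hi j
    simpa [Fin.is_le j] using hPy i hi j (Nat.lt_succ_iff.1 j.2)
  · intro α l hl
    have hdvd : ∀ i, Polynomial.X ^ (m + 1) ∣
        jetArc (fun p : σ × Fin (m + 1) => (P p.1).coeff p.2) i - P i := by
      intro i
      rw [Polynomial.X_pow_dvd_iff]
      intro d hd
      have := jetArc_coeff (fun p : σ × Fin (m + 1) => (P p.1).coeff p.2) i ⟨d, hd⟩
      simp only at this
      rw [Polynomial.coeff_sub, this, sub_self]
    have := Polynomial.X_pow_dvd_iff.1
      (MvPolynomial.aeval_sub_aeval_of_X_pow_dvd (Nat.succ_ne_zero m) hdvd (F α)).1 l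
      (Nat.lt_succ_iff.2 hl)
    rwa [Polynomial.coeff_sub, hPF α l hl, sub_zero] at this

theorem Matrix.exists_det_submatrix_ne_zero {L : Type*} [Field L] {r : ℕ} {ι : Type*} [Fintype ι]
    (M : Matrix (Fin r) ι L) (h : Function.Surjective M.mulVecLin) :
    ∃ c : Fin r → ι, (M.submatrix id c).det ≠ 0 := by
  obtain ⟨κ, a, ha, hspan, hli⟩ := exists_linearIndependent' L M.col
  rw [← Matrix.range_mulVecLin, LinearMap.range_eq_top.2 h] at hspan
  let b := Module.Basis.mk hli hspan.ge
  have : Fintype κ := FiniteDimensional.fintypeBasisIndex b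
  have hcard : Fintype.card κ = r := by
    rw [← Module.finrank_eq_card_basis b]
    simp
  let e : Fin r ≃ κ := (Fintype.equivFinOfCardEq hcard).symm
  refine ⟨a ∘ e, ?_⟩
  rw [← isUnit_iff_ne_zero, ← Matrix.isUnit_iff_isUnit_det,
    ← Matrix.linearIndependent_cols_iff_isUnit]
  exact hli.comp e e.injective

theorem Derivation.eq_zero_of_forall_mem_eq_zero {k L : Type*} [Field k] [Field L] [Algebra k L]
    (s : Set L) [Algebra.IsSeparable (IntermediateField.adjoin k s) L] (D : Derivation k L L)
    (hD : ∀ a ∈ s, D a = 0) : D = 0 := by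
  have hE : ∀ a ∈ IntermediateField.adjoin k s, D a = 0 := by
    intro a ha
    induction ha using IntermediateField.adjoin_induction with
    | mem x hx => exact hD x hx
    | algebraMap x => exact D.map_algebraMap x
    | add x y _ _ hx hy => rw [map_add, hx, hy, add_zero]
    | inv x _ hx => rw [D.leibniz_inv, hx, smul_zero]
    | mul x y _ _ hx hy => rw [D.leibniz, hx, hy, smul_zero, smul_zero, add_zero]
  have : Algebra.FormallyUnramified (IntermediateField.adjoin k s) L :=
    Algebra.FormallyUnramified.of_isSeparable _ _
  let D' : Derivation (IntermediateField.adjoin k s) L L :=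
    { toFun := D
      map_add' := map_add D
      map_smul' := fun a x => by
        simp [Algebra.smul_def, D.leibniz, hE _ a.2, IntermediateField.algebraMap_apply]
      map_one_eq_zero' := D.map_one_eq_zero
      leibniz' := D.leibniz }
  have h0 : D' = 0 := by
    rw [← D'.liftKaehlerDifferential_comp, Subsingleton.elim D'.liftKaehlerDifferential 0]
    ext
    simp
  ext x
  exact DFunLike.congr_fun h0 x

theorem finrank_derivation_le_of_trdeg_eq {k L : Type*} [Field k] [PerfectField k] [Field L]
    [Algebra k L] [Algebra.EssFiniteType k L] {n : ℕ} (hn : Algebra.trdeg k L = n) :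
    Module.Finite L (Derivation k L L) ∧ Module.finrank L (Derivation k L L) ≤ n := by
  obtain ⟨s, hs, _⟩ := exists_isTranscendenceBasis_and_isSeparable_of_perfectField k L
  have hcard : s.card = n := by
    have := hs.cardinalMk_eq_trdeg
    rw [hn] at this
    simpa using this
  let e : Derivation k L L →ₗ[L] (s → L) :=
    { toFun := fun D a => D a
      map_add' := fun _ _ => rfl
      map_smul' := fun _ _ => rfl }
  have he : Function.Injective e := by
    rw [← LinearMap.ker_eq_bot, LinearMap.ker_eq_bot']
    intro D hD
    exact D.eq_zero_of_forall_mem_eq_zero (s : Set L) fun a ha => congrFun hD ⟨a, ha⟩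
  refine ⟨Module.Finite.of_injective e he, ?_⟩
  calc _ ≤ Module.finrank L (s → L) := LinearMap.finrank_le_finrank_of_injective he
    _ = n := by simp [hcard]

theorem MvPolynomial.aeval_inl_add_inr {k : Type*} [CommRing k] {σ : Type*} [Fintype σ]
    {L : Type*} [CommRing L] [Algebra k L] (x δ : σ → L) (f : MvPolynomial σ k) :
    aeval (fun i => TrivSqZeroExt.inl (x i) + TrivSqZeroExt.inr (δ i) : σ → DualNumber L) f =
      TrivSqZeroExt.inl (aeval x f) +
        TrivSqZeroExt.inr (∑ i, aeval x (pderiv i f) * δ i) := by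
  classical
  induction f using MvPolynomial.induction_on with
  | C a => simp [TrivSqZeroExt.algebraMap_eq_inl']
  | add f g hf hg =>
    rw [map_add, hf, hg]
    ext <;> simp [add_mul, Finset.sum_add_distrib]
  | mul_X f j hf =>
    rw [map_mul, hf, aeval_X]
    ext
    · simp
    · simp only [TrivSqZeroExt.snd_mul, TrivSqZeroExt.snd_add, TrivSqZeroExt.snd_inl,
        TrivSqZeroExt.snd_inr, TrivSqZeroExt.fst_add, TrivSqZeroExt.fst_inl,
        TrivSqZeroExt.fst_inr, Derivation.leibniz, pderiv_X, map_add, smul_eq_mul, add_mul,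
        Finset.sum_add_distrib, map_mul, aeval_X, MulOpposite.smul_eq_mul_unop,
        MulOpposite.unop_op, zero_add, add_zero]
      have h1 : ∑ i, aeval x f * aeval x (Pi.single (M := fun _ => MvPolynomial σ k) i 1 j) * δ i =
          aeval x f * δ j := by
        simp [Pi.single_apply, apply_ite]
      have h2 : ∑ i, x j * aeval x (pderiv i f) * δ i =
          (∑ i, aeval x (pderiv i f) * δ i) * x j := by
        rw [Finset.sum_mul]
        exact Finset.sum_congr rfl fun i _ => by ring
      rw [h1, h2]
      ring

theorem exists_derivation_fractionRing {k : Type*} [Field k] {σ : Type*} [Fintype σ]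
    {ι : Type*} {F : ι → MvPolynomial σ k} {I : Ideal (MvPolynomial σ k)}
    (hI : I = Ideal.span (Set.range F)) [IsDomain (MvPolynomial σ k ⧸ I)]
    {L : Type*} [Field L] [Algebra k L] [Algebra (MvPolynomial σ k ⧸ I) L]
    [IsScalarTower k (MvPolynomial σ k ⧸ I) L]
    [IsFractionRing (MvPolynomial σ k ⧸ I) L]
    {x : σ → L} (hx : ∀ i, x i = algebraMap (MvPolynomial σ k ⧸ I) L
      (Ideal.Quotient.mk _ (MvPolynomial.X i)))
    (δ : σ → L)
    (hδ : ∀ α, ∑ i, MvPolynomial.aeval x (MvPolynomial.pderiv i (F α)) * δ i = 0) :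
    ∃ D : Derivation k L L, ∀ i, D (x i) = δ i := by
  have hxf : ∀ f, MvPolynomial.aeval x f = algebraMap (MvPolynomial σ k ⧸ I) L
      (Ideal.Quotient.mk I f) := by
    have : MvPolynomial.aeval x = (IsScalarTower.toAlgHom k (MvPolynomial σ k ⧸ I) L).comp
        (Ideal.Quotient.mkₐ k I) := by
      ext i
      simp [hx]
    intro f
    rw [this]
    simp
  let φ : MvPolynomial σ k →ₐ[k] DualNumber L := MvPolynomial.aeval
    (fun i => TrivSqZeroExt.inl (x i) + TrivSqZeroExt.inr (δ i))
  have hφ : ∀ a ∈ I, φ a = 0 := by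
    have : I ≤ RingHom.ker φ := by
      rw [hI, Ideal.span_le]
      rintro _ ⟨α, rfl⟩
      rw [SetLike.mem_coe, RingHom.mem_ker]
      simp only [φ]
      rw [MvPolynomial.aeval_inl_add_inr, hδ, hxf, Ideal.Quotient.eq_zero_iff_mem.2
        (hI ▸ Ideal.subset_span (Set.mem_range_self α))]
      simp
    exact fun a ha => this ha
  let ψ : (MvPolynomial σ k ⧸ I) →ₐ[k] DualNumber L := Ideal.Quotient.liftₐ I φ hφ
  have hψmk : ∀ f, ψ (Ideal.Quotient.mk I f) = φ f := fun f => rfl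
  have hψ : ∀ d, (ψ d).fst = algebraMap _ L d := by
    intro d
    obtain ⟨f, rfl⟩ := Ideal.Quotient.mk_surjective d
    rw [hψmk, ← hxf]
    simp only [φ]
    rw [MvPolynomial.aeval_inl_add_inr]
    simp
  have hu : ∀ y : nonZeroDivisors (MvPolynomial σ k ⧸ I), IsUnit (ψ y) := by
    intro y
    rw [TrivSqZeroExt.isUnit_iff_isUnit_fst, hψ]
    exact IsLocalization.map_units L y
  let Ψ : L →ₐ[k] DualNumber L := IsLocalization.liftAlgHom (M := nonZeroDivisors _) (f := ψ) hu
  have hΨ : ∀ d, Ψ (algebraMap _ L d) = ψ d := fun d => IsLocalization.lift_eq _ d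
  have hfst : ∀ z, (Ψ z).fst = z := by
    have : ((TrivSqZeroExt.fstHom k L L).comp Ψ : L →+* L) = RingHom.id L :=
      IsLocalization.ringHom_ext (nonZeroDivisors (MvPolynomial σ k ⧸ I)) (by
        ext d
        · simp [hΨ, hψ]
        · simp [hΨ, hψ])
    exact fun z => RingHom.congr_fun this z
  refine ⟨Derivation.mk' ((TrivSqZeroExt.sndHom L L).restrictScalars k ∘ₗ Ψ.toLinearMap)
    fun a b => ?_, fun i => ?_⟩
  · simp [hfst, mul_comm]
  · simp [hx, hΨ, hψmk, φ]

theorem exists_jacobianMinor_det_notMem {k : Type*} [Field k] [PerfectField k] {N n : ℕ}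
    (hn : n ≤ N) (F : Fin (N - n) → MvPolynomial (Fin N) k)
    {I : Ideal (MvPolynomial (Fin N) k)} (hI : I = Ideal.span (Set.range F))
    [IsDomain (MvPolynomial (Fin N) k ⧸ I)]
    (hdim : ringKrullDim (MvPolynomial (Fin N) k ⧸ I) = n) :
    ∃ c, (jacobianMinor F c).det ∉ I := by
  let L := FractionRing (MvPolynomial (Fin N) k ⧸ I)
  obtain ⟨s, hs, hst⟩ := exists_natCast_eq_ringKrullDim_and_trdeg k
    (C := MvPolynomial (Fin N) k ⧸ I)
  have hsn : s = n := by
    rw [hdim] at hs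
    exact_mod_cast hs.symm
  have htr : Algebra.trdeg k L = n := by
    have : Algebra.IsAlgebraic (MvPolynomial (Fin N) k ⧸ I) L :=
      IsLocalization.isAlgebraic _ (nonZeroDivisors _)
    have := trdeg_add_eq k (MvPolynomial (Fin N) k ⧸ I) (A := L)
    rw [trdeg_eq_zero (R := MvPolynomial (Fin N) k ⧸ I), add_zero, hst, hsn] at this
    exact this.symm
  have : Algebra.EssFiniteType (MvPolynomial (Fin N) k ⧸ I) L :=
    Algebra.EssFiniteType.of_isLocalization _ (nonZeroDivisors _)
  have : Algebra.EssFiniteType k L := Algebra.EssFiniteType.comp k (MvPolynomial (Fin N) k ⧸ I) L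
  obtain ⟨hfin, hle⟩ := finrank_derivation_le_of_trdeg_eq htr
  let x : Fin N → L := fun i => algebraMap (MvPolynomial (Fin N) k ⧸ I) L
      (Ideal.Quotient.mk _ (MvPolynomial.X i))
  let M : Matrix (Fin (N - n)) (Fin N) L := Matrix.of fun α i =>
    MvPolynomial.aeval x (MvPolynomial.pderiv i (F α))
  let θ : Derivation k L L →ₗ[L] (Fin N → L) :=
    { toFun := fun D i => D (x i)
      map_add' := fun _ _ => rfl
      map_smul' := fun _ _ => rfl }
  have hker : LinearMap.ker M.mulVecLin ≤ LinearMap.range θ := by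
    intro δ hδ
    obtain ⟨D, hD⟩ := exists_derivation_fractionRing hI (x := x) (fun i => rfl) δ
      (fun α => congrFun (LinearMap.mem_ker.1 hδ) α)
    exact ⟨D, funext hD⟩
  have h1 : Module.finrank L (LinearMap.ker M.mulVecLin) ≤ n :=
    (Submodule.finrank_mono hker).trans ((LinearMap.finrank_range_le θ).trans hle)
  have h2 := LinearMap.finrank_range_add_finrank_ker M.mulVecLin
  have hsurj : Function.Surjective M.mulVecLin := by
    rw [← LinearMap.range_eq_top]
    apply Submodule.eq_top_of_finrank_eq
    have h3 := Submodule.finrank_le (LinearMap.range M.mulVecLin)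
    simp only [Module.finrank_fintype_fun_eq_card, Fintype.card_fin] at h2 h3 ⊢
    omega
  obtain ⟨c, hc⟩ := M.exists_det_submatrix_ne_zero hsurj
  refine ⟨c, fun hmem => hc ?_⟩
  have e : M.submatrix id c = (MvPolynomial.aeval x).mapMatrix (jacobianMinor F c) := by
    ext α β
    simp [M, jacobianMinor]
  have hxf : MvPolynomial.aeval x = (IsScalarTower.toAlgHom k (MvPolynomial (Fin N) k ⧸ I) L).comp
      (Ideal.Quotient.mkₐ k I) := by
    ext i
    simp [x]
  rw [e, ← AlgHom.map_det, hxf]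
  simp [Ideal.Quotient.eq_zero_iff_mem.2 hmem]

theorem span_le_comap_rename_of_jetIdeal_le {k : Type*} [CommRing k] {σ : Type*} {m : ℕ}
    {F : Set (MvPolynomial σ k)} {p : Ideal (MvPolynomial (σ × Fin (m + 1)) k)}
    (hp : jetIdeal k σ m F ≤ p) :
    Ideal.span F ≤ p.comap (MvPolynomial.rename fun i => (i, (0 : Fin (m + 1)))) := by
  rw [Ideal.span_le]
  intro f hf
  refine Ideal.mem_comap.2 (hp (Ideal.subset_span ⟨f, hf, 0, Nat.zero_le _, ?_⟩))
  rw [jetSub, MvPolynomial.coeff_zero_aeval, ← MvPolynomial.aeval_X_left_apply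
    (MvPolynomial.rename _ f), MvPolynomial.aeval_rename]
  congr 2
  ext1 i
  exact (jetArc_coeff (MvPolynomial.X : _ → MvPolynomial (σ × Fin (m + 1)) k) i 0).symm

section JetComponent

variable {k : Type*} [Field k] {σ : Type*} {r : ℕ} {F : Fin r → MvPolynomial σ k}
  {I : Ideal (MvPolynomial σ k)}

/-- The localization of the coordinate ring away from a Jacobian minor. -/
abbrev MinorLocalization (F : Fin r → MvPolynomial σ k) (I : Ideal (MvPolynomial σ k))
    (c : Fin r → σ) : Type _ :=
  Localization.Away (Ideal.Quotient.mk I (jacobianMinor F c).det)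

theorem isDomain_minorLocalization [IsDomain (MvPolynomial σ k ⧸ I)] {c : Fin r → σ}
    (hc : (jacobianMinor F c).det ∉ I) : IsDomain (MinorLocalization F I c) :=
  IsLocalization.isDomain_localization (powers_le_nonZeroDivisors_of_noZeroDivisors
    (mt Ideal.Quotient.eq_zero_iff_mem.1 hc))

theorem algebraMap_minorLocalization_eq_zero_iff [IsDomain (MvPolynomial σ k ⧸ I)] {c : Fin r → σ}
    (hc : (jacobianMinor F c).det ∉ I) (f : MvPolynomial σ k) :
    algebraMap _ (MinorLocalization F I c) (Ideal.Quotient.mk I f) = 0 ↔ f ∈ I := by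
  rw [← Ideal.Quotient.eq_zero_iff_mem]
  exact map_eq_zero_iff _ (IsLocalization.injective _
    (powers_le_nonZeroDivisors_of_noZeroDivisors (mt Ideal.Quotient.eq_zero_iff_mem.1 hc)))

/-- The coordinate ring of the jets over the locus where a given Jacobian minor is invertible. -/
abbrev MinorJetRing (F : Fin r → MvPolynomial σ k) (I : Ideal (MvPolynomial σ k))
    (c : Fin r → σ) (m : ℕ) : Type _ :=
  MvPolynomial (↥(Set.range c)ᶜ × Fin m) (MinorLocalization F I c)

/-- The canonical map from polynomials to the coordinate ring of jets over the locus where a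
given Jacobian minor is invertible. -/
def toMinorJetRing (F : Fin r → MvPolynomial σ k) (I : Ideal (MvPolynomial σ k))
    (c : Fin r → σ) (m : ℕ) : MvPolynomial σ k →ₐ[k] MinorJetRing F I c m :=
  ((IsScalarTower.toAlgHom k (MinorLocalization F I c) (MinorJetRing F I c m)).comp
    (IsScalarTower.toAlgHom k (MvPolynomial σ k ⧸ I) (MinorLocalization F I c))).comp
      (Ideal.Quotient.mkₐ k I)

theorem toMinorJetRing_apply (c : Fin r → σ) (m : ℕ) (f : MvPolynomial σ k) :
    toMinorJetRing F I c m f =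
      MvPolynomial.C (algebraMap _ (MinorLocalization F I c) (Ideal.Quotient.mk I f)) := rfl

theorem toMinorJetRing_eq_zero (c : Fin r → σ) (m : ℕ) {f : MvPolynomial σ k} (hf : f ∈ I) :
    toMinorJetRing F I c m f = 0 := by
  rw [toMinorJetRing_apply]
  simp only [Ideal.Quotient.eq_zero_iff_mem.2 hf, map_zero]

theorem isUnit_toMinorJetRing (c : Fin r → σ) (m : ℕ) :
    IsUnit (toMinorJetRing F I c m (jacobianMinor F c).det) := by
  rw [toMinorJetRing_apply]
  exact (IsLocalization.Away.algebraMap_isUnit _).map _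

theorem exists_universal_jet [Fintype σ] (hI : I = Ideal.span (Set.range F)) {c : Fin r → σ}
    (hinj : Function.Injective c) (m : ℕ) :
    ∃ γ : σ × Fin (m + 1) → MinorJetRing F I c m,
      (∀ i, γ (i, 0) = toMinorJetRing F I c m (MvPolynomial.X i)) ∧
      (∀ (i : ↥(Set.range c)ᶜ) (j : Fin m), γ (i, j.succ) = MvPolynomial.X (i, j)) ∧
      jetIdeal k σ m (Set.range F) ≤ RingHom.ker (MvPolynomial.aeval (R := k) γ) := by
  classical
  let y : σ × Fin (m + 1) → MinorJetRing F I c m := fun p =>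
    Fin.cases (toMinorJetRing F I c m (MvPolynomial.X p.1))
      (fun j => if h : p.1 ∈ (Set.range c)ᶜ then MvPolynomial.X (⟨p.1, h⟩, j) else 0) p.2
  have hy0 : (fun i => y (i, 0)) = fun i => toMinorJetRing F I c m (MvPolynomial.X i) := rfl
  have haev : MvPolynomial.aeval (fun i => y (i, 0)) = toMinorJetRing F I c m := by
    rw [hy0]
    exact (MvPolynomial.aeval_unique _).symm
  obtain ⟨γ, h0, hfree, hγ⟩ := exists_jet_of_isUnit_jacobianMinor (F := F) hinj y
    (fun α => by
      rw [haev]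
      exact toMinorJetRing_eq_zero c m (hI ▸ Ideal.subset_span (Set.mem_range_self α)))
    (by rw [haev]; exact isUnit_toMinorJetRing c m)
  refine ⟨γ, h0, fun i j => ?_, ?_⟩
  · rw [hfree i i.2]
    exact dif_pos i.2
  · rw [jetIdeal_le_ker_aeval_iff]
    rintro _ ⟨α, rfl⟩
    exact hγ α

theorem ker_aeval_jet_le [Fintype σ] (hI : I = Ideal.span (Set.range F)) {c : Fin r → σ}
    (hinj : Function.Injective c) {m : ℕ} {γ : σ × Fin (m + 1) → MinorJetRing F I c m}
    (h0 : ∀ i, γ (i, 0) = toMinorJetRing F I c m (MvPolynomial.X i))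
    (hfree : ∀ (i : ↥(Set.range c)ᶜ) (j : Fin m), γ (i, j.succ) = MvPolynomial.X (i, j))
    (hγ : jetIdeal k σ m (Set.range F) ≤ RingHom.ker (MvPolynomial.aeval (R := k) γ))
    {p : Ideal (MvPolynomial (σ × Fin (m + 1)) k)} [p.IsPrime]
    (hp : jetIdeal k σ m (Set.range F) ≤ p)
    (hdet : MvPolynomial.rename (fun i => (i, (0 : Fin (m + 1)))) (jacobianMinor F c).det ∉ p) :
    RingHom.ker (MvPolynomial.aeval (R := k) γ) ≤ p := by
  let Q := FractionRing (MvPolynomial (σ × Fin (m + 1)) k ⧸ p)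
  let q : MvPolynomial (σ × Fin (m + 1)) k →ₐ[k] Q :=
    (IsScalarTower.toAlgHom k (MvPolynomial (σ × Fin (m + 1)) k ⧸ p) Q).comp
      (Ideal.Quotient.mkₐ k p)
  have hq : ∀ f, q f = 0 ↔ f ∈ p := fun f => by
    rw [← Ideal.Quotient.eq_zero_iff_mem]
    exact map_eq_zero_iff (algebraMap (MvPolynomial (σ × Fin (m + 1)) k ⧸ p) Q)
      (IsFractionRing.injective _ Q)
  let v : σ × Fin (m + 1) → Q := fun p => q (MvPolynomial.X p)
  have hv : MvPolynomial.aeval v = q := (MvPolynomial.aeval_unique q).symm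
  let q0 : MvPolynomial σ k →ₐ[k] Q := q.comp (MvPolynomial.rename fun i => (i, 0))
  have hv0 : MvPolynomial.aeval (fun i => v (i, 0)) = q0 := by
    ext i
    simp [v, q0]
  have hIq : ∀ a ∈ I, q0 a = 0 := fun a ha =>
    (hq _).2 (span_le_comap_rename_of_jetIdeal_le hp (hI ▸ ha))
  let q1 : (MvPolynomial σ k ⧸ I) →ₐ[k] Q := Ideal.Quotient.liftₐ I q0 hIq
  have hu : ∀ s : Submonoid.powers (Ideal.Quotient.mk I (jacobianMinor F c).det),
      IsUnit (q1 s) := by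
    rintro ⟨_, e, rfl⟩
    rw [map_pow]
    refine IsUnit.pow _ (isUnit_iff_ne_zero.2 fun h => hdet ((hq _).1 h))
  let ψ₀ : MinorLocalization F I c →ₐ[k] Q := IsLocalization.liftAlgHom (f := q1) hu
  have hψ₀ : ∀ f, ψ₀ (algebraMap _ _ (Ideal.Quotient.mk I f)) = q0 f := fun f =>
    IsLocalization.lift_eq _ _
  let _ : Algebra (MinorLocalization F I c) Q := ψ₀.toRingHom.toAlgebra
  have : IsScalarTower k (MinorLocalization F I c) Q :=
    IsScalarTower.of_algebraMap_eq' ψ₀.comp_algebraMap.symm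
  let ψ : MinorJetRing F I c m →ₐ[k] Q := (MvPolynomial.aeval
    (fun a : ↥(Set.range c)ᶜ × Fin m => v (a.1, a.2.succ))).restrictScalars k
  have hψ : ∀ f, ψ (toMinorJetRing F I c m f) = q0 f := fun f => by
    rw [← hψ₀, toMinorJetRing_apply]
    exact MvPolynomial.aeval_C _ _
  have hcomp : MvPolynomial.aeval (ψ ∘ γ) = ψ.comp (MvPolynomial.aeval γ) :=
    (MvPolynomial.comp_aeval γ ψ).symm
  have hψγ : ψ ∘ γ = v := by
    have h1 : jetIdeal k σ m (Set.range F) ≤ RingHom.ker (MvPolynomial.aeval (R := k) (ψ ∘ γ)) := by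
      intro f hf
      rw [RingHom.mem_ker, hcomp, AlgHom.comp_apply, (RingHom.mem_ker).1 (hγ hf), map_zero]
    have h2 : jetIdeal k σ m (Set.range F) ≤ RingHom.ker (MvPolynomial.aeval (R := k) v) := by
      intro f hf
      rw [RingHom.mem_ker, hv, hq]
      exact hp hf
    rw [jetIdeal_le_ker_aeval_iff] at h1 h2
    refine jet_eq_of_jacobianMinor_ne_zero hinj (fun α => h2 _ ⟨α, rfl⟩)
      (fun α => h1 _ ⟨α, rfl⟩) ?_ ?_ ?_
    · rw [hv0]
      exact fun h => hdet ((hq _).1 h)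
    · intro i
      simp [h0, hψ, q0, v]
    · intro i hi j
      induction j using Fin.cases with
      | zero => simp [h0, hψ, q0, v]
      | succ j =>
        have := hfree ⟨i, hi⟩ j
        simp only at this
        rw [Function.comp_apply, this]
        exact MvPolynomial.aeval_X _ _
  intro f hf
  rw [← hq, ← hv, ← hψγ, hcomp, AlgHom.comp_apply, RingHom.mem_ker.1 hf, map_zero]

end JetComponent

/-- There is a prime ideal, containing the jet ideal, which is the generic point of the closure of
the jets lying over the locus where a given Jacobian minor does not vanish. -/
theorem exists_isPrime_jetIdeal_le {k : Type*} [Field k] {N n : ℕ} (hn : n ≤ N)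
    {F : Fin (N - n) → MvPolynomial (Fin N) k} {I : Ideal (MvPolynomial (Fin N) k)}
    (hI : I = Ideal.span (Set.range F)) [IsDomain (MvPolynomial (Fin N) k ⧸ I)]
    (hdim : ringKrullDim (MvPolynomial (Fin N) k ⧸ I) = n) (m : ℕ) {c : Fin (N - n) → Fin N}
    (hc : (jacobianMinor F c).det ∉ I) :
    ∃ p : Ideal (MvPolynomial (Fin N × Fin (m + 1)) k), p.IsPrime ∧
      jetIdeal k (Fin N) m (Set.range F) ≤ p ∧
      p.comap (MvPolynomial.rename fun i => (i, (0 : Fin (m + 1)))) = I ∧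
      (∀ q : Ideal (MvPolynomial (Fin N × Fin (m + 1)) k), q.IsPrime →
        jetIdeal k (Fin N) m (Set.range F) ≤ q →
        MvPolynomial.rename (fun i => (i, (0 : Fin (m + 1)))) (jacobianMinor F c).det ∉ q →
        p ≤ q) ∧
      ringKrullDim (MvPolynomial (Fin N × Fin (m + 1)) k ⧸ p) ≤ (n * (m + 1) : ℕ) := by
  have hinj : Function.Injective c :=
    jacobianMinor_injective (F := F) fun h => hc (h ▸ I.zero_mem)
  have := isDomain_minorLocalization hc
  obtain ⟨γ, h0, hfree, hγ⟩ := exists_universal_jet hI hinj m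
  have hprime : (RingHom.ker (MvPolynomial.aeval (R := k) γ)).IsPrime := RingHom.ker_isPrime _
  refine ⟨RingHom.ker (MvPolynomial.aeval (R := k) γ), hprime, hγ, ?_,
    fun q hq hJq hgq => ker_aeval_jet_le hI hinj h0 hfree hγ hJq hgq, ?_⟩
  · ext f
    have : (MvPolynomial.aeval fun i => γ (i, 0)) = toMinorJetRing F I c m := by
      simp only [h0]
      exact (MvPolynomial.aeval_unique _).symm
    rw [Ideal.mem_comap, RingHom.mem_ker, MvPolynomial.aeval_rename,
      ← algebraMap_minorLocalization_eq_zero_iff hc,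
      ← map_eq_zero_iff (MvPolynomial.C : _ →+* MinorJetRing F I c m) (MvPolynomial.C_injective _ _),
      ← toMinorJetRing_apply, ← this]
    rfl
  · obtain ⟨s, hs, hst⟩ := exists_natCast_eq_ringKrullDim_and_trdeg k
      (C := MvPolynomial (Fin N × Fin (m + 1)) k ⧸ RingHom.ker (MvPolynomial.aeval (R := k) γ))
    obtain ⟨d, hd, hdt⟩ := exists_natCast_eq_ringKrullDim_and_trdeg k
      (C := MvPolynomial (Fin N) k ⧸ I)
    obtain rfl : n = d := by
      rw [hdim] at hd
      exact_mod_cast hd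
    have h1 : Algebra.trdeg k (MinorLocalization F I c) = n := by
      have hinjS : Function.Injective (algebraMap (MvPolynomial (Fin N) k ⧸ I)
          (MinorLocalization F I c)) := IsLocalization.injective _
        (powers_le_nonZeroDivisors_of_noZeroDivisors (mt Ideal.Quotient.eq_zero_iff_mem.1 hc))
      have : FaithfulSMul (MvPolynomial (Fin N) k ⧸ I) (MinorLocalization F I c) :=
        (faithfulSMul_iff_algebraMap_injective _ _).2 hinjS
      have : Algebra.IsAlgebraic (MvPolynomial (Fin N) k ⧸ I) (MinorLocalization F I c) :=
        IsLocalization.isAlgebraic _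
          (Submonoid.powers (Ideal.Quotient.mk I (jacobianMinor F c).det))
      rw [← trdeg_add_eq k (MvPolynomial (Fin N) k ⧸ I) (A := MinorLocalization F I c),
        trdeg_eq_zero (R := MvPolynomial (Fin N) k ⧸ I), add_zero, hdt]
    have : FaithfulSMul k (MinorLocalization F I c) :=
      (faithfulSMul_iff_algebraMap_injective _ _).2 (algebraMap k (MinorLocalization F I c)).injective
    have h2 : Algebra.trdeg k (MinorJetRing F I c m) = (n * (m + 1) : ℕ) := by
      rw [← trdeg_add_eq k (MinorLocalization F I c) (A := MinorJetRing F I c m), h1,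
        MvPolynomial.trdeg_of_isDomain]
      have hcard : Fintype.card ↥(Set.range c)ᶜ = n := by
        rw [Fintype.card_compl_set, Set.card_range_of_injective hinj]
        simp
        omega
      simp [hcard, mul_add, add_comm]
    have h3 := trdeg_le_of_injective
      (Ideal.kerLiftAlg (MvPolynomial.aeval (R := k) γ)) (Ideal.kerLiftAlg_injective _)
    rw [hst, h2] at h3
    rw [hs]
    exact_mod_cast h3

theorem spanFinrank_jetIdeal_le {k : Type*} [CommRing k] {σ : Type*} {r : ℕ} (m : ℕ)
    (F : Fin r → MvPolynomial σ k) :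
    (jetIdeal k σ m (Set.range F)).spanFinrank ≤ r * (m + 1) := by
  have : {g | ∃ f ∈ Set.range F, ∃ l ≤ m, g = Polynomial.coeff (jetSub k σ m f) l} =
      (fun a : Fin r × Fin (m + 1) => Polynomial.coeff (jetSub k σ m (F a.1)) a.2) '' Set.univ := by
    ext g
    constructor
    · rintro ⟨_, ⟨α, rfl⟩, l, hl, rfl⟩
      exact ⟨(α, ⟨l, Nat.lt_succ_of_le hl⟩), Set.mem_univ _, rfl⟩
    · rintro ⟨⟨α, l⟩, -, rfl⟩
      exact ⟨_, ⟨α, rfl⟩, l, Fin.is_le l, rfl⟩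
  rw [jetIdeal, this]
  refine (Submodule.spanFinrank_span_le_ncard_of_finite (Set.toFinite _)).trans
    ((Set.ncard_image_le (Set.toFinite _)).trans ?_)
  simp

theorem le_ringKrullDim_quotient_of_mem_minimalPrimes_jetIdeal {k : Type*} [Field k] {N n : ℕ}
    (hn : n ≤ N) {m : ℕ} {F : Fin (N - n) → MvPolynomial (Fin N) k}
    {p : Ideal (MvPolynomial (Fin N × Fin (m + 1)) k)}
    (hp : p ∈ (jetIdeal k (Fin N) m (Set.range F)).minimalPrimes) :
    (n * (m + 1) : ℕ) ≤ ringKrullDim (MvPolynomial (Fin N × Fin (m + 1)) k ⧸ p) := by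
  have : p.IsPrime := hp.1.1
  have h1 := natCard_le_ringKrullDim_quotient_add_of_mem_minimalPrimes hp
  have h2 := spanFinrank_jetIdeal_le m F
  obtain ⟨s, hs, -⟩ := exists_natCast_eq_ringKrullDim_and_trdeg k
    (C := MvPolynomial (Fin N × Fin (m + 1)) k ⧸ p)
  rw [hs] at h1 ⊢
  simp only [Nat.card_prod, Nat.card_fin] at h1
  have h3 : N * (m + 1) ≤ s + (jetIdeal k (Fin N) m (Set.range F)).spanFinrank := by
    exact_mod_cast h1
  have h4 : n * (m + 1) + (N - n) * (m + 1) = N * (m + 1) := by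
    rw [← add_mul, Nat.add_sub_cancel' hn]
  have h5 : n * (m + 1) ≤ s := by omega
  exact_mod_cast h5

theorem ringKrullDim_quotient_lt_of_forall_minimalPrimes (k : Type*) [Field k] {R : Type*}
    [CommRing R] [Algebra k R] [Algebra.FiniteType k R] (J : Ideal R) (d : ℕ)
    (h : ∀ p ∈ J.minimalPrimes, ringKrullDim (R ⧸ p) < d) : ringKrullDim (R ⧸ J) < d := by
  cases d with
  | zero =>
    refine (ringKrullDim_quotient_le_of_forall_minimalPrimes J ⊥ fun p hp => ?_).trans_lt
      (WithBot.bot_lt_coe _)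
    have : p.IsPrime := hp.1.1
    exact absurd (h p hp) (not_lt.2 (by simpa using ringKrullDim_nonneg_of_nontrivial))
  | succ d =>
    refine (ringKrullDim_quotient_le_of_forall_minimalPrimes J d fun p hp => ?_).trans_lt
      (by exact_mod_cast Nat.lt_succ_self d)
    have : p.IsPrime := hp.1.1
    obtain ⟨s, hs, -⟩ := exists_natCast_eq_ringKrullDim_and_trdeg k (C := R ⧸ p)
    have := h p hp
    rw [hs] at this ⊢
    have h' : s < d + 1 := by exact_mod_cast this
    exact_mod_cast Nat.lt_succ_iff.1 h'

theorem ringKrullDim_quotient_succ_le_of_mem_of_notMem {R : Type*} [CommRing R] {p q : Ideal R}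
    [p.IsPrime] (hpq : p ≤ q) {g : R} (hgq : g ∈ q) (hgp : g ∉ p) :
    ringKrullDim (R ⧸ q) + 1 ≤ ringKrullDim (R ⧸ p) := by
  refine ringKrullDim_succ_le_of_surjective (Ideal.Quotient.factor hpq)
    (Ideal.Quotient.factor_surjective hpq) (r := Ideal.Quotient.mk p g)
    (mem_nonZeroDivisors_of_ne_zero (mt Ideal.Quotient.eq_zero_iff_mem.1 hgp)) ?_
  rw [Ideal.Quotient.factor_mk, Ideal.Quotient.eq_zero_iff_mem]
  exact hgq

theorem rename_det_mem_jetOverIdeal {k : Type*} [CommRing k] {N r : ℕ} (m : ℕ)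
    (F : Fin r → MvPolynomial (Fin N) k) (c : Fin r → Fin N) :
    MvPolynomial.rename (fun i => (i, (0 : Fin (m + 1)))) (jacobianMinor F c).det ∈
      jetOverIdeal k (Fin N) m (Set.range F) (lciSingEquations k F) :=
  Ideal.mem_sup_right (Ideal.subset_span ⟨_, Or.inr ⟨c, rfl⟩, rfl⟩)

theorem jetOverIdeal_le_of_forall_det_mem {k : Type*} [CommRing k] {N r m : ℕ}
    {F : Fin r → MvPolynomial (Fin N) k} {p : Ideal (MvPolynomial (Fin N × Fin (m + 1)) k)}
    (hp : jetIdeal k (Fin N) m (Set.range F) ≤ p)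
    (h : ∀ c, MvPolynomial.rename (fun i => (i, (0 : Fin (m + 1)))) (jacobianMinor F c).det ∈ p) :
    jetOverIdeal k (Fin N) m (Set.range F) (lciSingEquations k F) ≤ p := by
  refine sup_le hp (Ideal.span_le.2 ?_)
  rintro _ ⟨g, hg | ⟨c, rfl⟩, rfl⟩
  · exact span_le_comap_rename_of_jetIdeal_le hp (Ideal.subset_span hg)
  · exact h c

/- STATEMENT 4: Let `X` be an l.c.i. variety of dimension `n` (cut out in `𝔸^N` by `N - n`
equations `F`), and `m ≥ 1`.  Then `X_m` is pure dimensional iff `dim X_m ≤ n(m+1)`, in which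
case `X_m` is again a (locally) complete intersection, i.e. the `(N-n)(m+1)` equations cut it
out in dimension exactly `n(m+1)`.  Moreover `X_m` is irreducible iff
`dim π_m^{-1}(X_sing) < n(m+1)`. -/
theorem stmt4 (k : Type*) [Field k] [IsAlgClosed k] (N n : ℕ) (hn : n ≤ N)
    (F : Fin (N - n) → MvPolynomial (Fin N) k)
    (hdom : IsDomain (MvPolynomial (Fin N) k ⧸ Ideal.span (Set.range F)))
    (hdim : ringKrullDim (MvPolynomial (Fin N) k ⧸ Ideal.span (Set.range F)) = n)
    (m : ℕ) (hm : 1 ≤ m) :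
    -- pure dimensionality of `X_m` is equivalent to `dim X_m ≤ n(m+1)` …
    ((∀ p ∈ (jetIdeal k (Fin N) m (Set.range F)).minimalPrimes,
        ∀ q ∈ (jetIdeal k (Fin N) m (Set.range F)).minimalPrimes,
          ringKrullDim (MvPolynomial (Fin N × Fin (m + 1)) k ⧸ p) =
            ringKrullDim (MvPolynomial (Fin N × Fin (m + 1)) k ⧸ q)) ↔
      ringKrullDim (MvPolynomial (Fin N × Fin (m + 1)) k ⧸
          jetIdeal k (Fin N) m (Set.range F)) ≤ (n * (m + 1) : ℕ)) ∧
    -- … in which case `X_m` is a complete intersection: its `(N-n)(m+1)` defining equations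
    -- cut out a scheme of dimension exactly `n(m+1)`, and every component has this dimension
    (ringKrullDim (MvPolynomial (Fin N × Fin (m + 1)) k ⧸
        jetIdeal k (Fin N) m (Set.range F)) ≤ (n * (m + 1) : ℕ) →
      (ringKrullDim (MvPolynomial (Fin N × Fin (m + 1)) k ⧸
          jetIdeal k (Fin N) m (Set.range F)) = (n * (m + 1) : ℕ) ∧
        ∀ p ∈ (jetIdeal k (Fin N) m (Set.range F)).minimalPrimes,
          ringKrullDim (MvPolynomial (Fin N × Fin (m + 1)) k ⧸ p) = (n * (m + 1) : ℕ))) ∧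
    -- irreducibility of `X_m` is equivalent to `dim π_m^{-1}(X_sing) < n(m+1)`
    ((jetIdeal k (Fin N) m (Set.range F)).radical.IsPrime ↔
      ringKrullDim (MvPolynomial (Fin N × Fin (m + 1)) k ⧸
          jetOverIdeal k (Fin N) m (Set.range F) (lciSingEquations k F)) <
        (n * (m + 1) : ℕ)) := by
  have hIprime : (Ideal.span (Set.range F)).IsPrime :=
    (Ideal.Quotient.isDomain_iff_prime _).1 hdom
  obtain ⟨c, hc⟩ := exists_jacobianMinor_det_notMem hn F rfl hdim
  obtain ⟨p₀, hp₀, hJp₀, hcomap, huniv, hle⟩ := exists_isPrime_jetIdeal_le hn rfl hdim m hc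
  have hge := fun p hp => le_ringKrullDim_quotient_of_mem_minimalPrimes_jetIdeal (m := m) (F := F)
    (p := p) hn hp
  have hg₀ : MvPolynomial.rename (fun i => (i, (0 : Fin (m + 1)))) (jacobianMinor F c).det ∉ p₀ :=
    fun h => hc (hcomap ▸ h)
  have hmin : p₀ ∈ (jetIdeal k (Fin N) m (Set.range F)).minimalPrimes :=
    ⟨⟨hp₀, hJp₀⟩, fun q hq hqp => huniv q hq.1 hq.2 fun h => hg₀ (hqp h)⟩
  have hdim₀ : ringKrullDim (MvPolynomial (Fin N × Fin (m + 1)) k ⧸ p₀) = (n * (m + 1) : ℕ) :=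
    le_antisymm hle (hge p₀ hmin)
  have hpure : ringKrullDim (MvPolynomial (Fin N × Fin (m + 1)) k ⧸
      jetIdeal k (Fin N) m (Set.range F)) ≤ (n * (m + 1) : ℕ) →
      ∀ p ∈ (jetIdeal k (Fin N) m (Set.range F)).minimalPrimes,
        ringKrullDim (MvPolynomial (Fin N × Fin (m + 1)) k ⧸ p) = (n * (m + 1) : ℕ) :=
    fun h p hp => le_antisymm ((ringKrullDim_quotient_mono hp.1.2).trans h) (hge p hp)
  refine ⟨⟨fun h => ?_, fun h p hp q hq => (hpure h p hp).trans (hpure h q hq).symm⟩,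
    fun h => ⟨le_antisymm h ?_, hpure h⟩, fun hrad => ?_, fun hlt => ?_⟩
  · exact ringKrullDim_quotient_le_of_forall_minimalPrimes _ _ fun p hp =>
      (h p hp p₀ hmin).trans_le hle
  · exact hdim₀.symm.le.trans (ringKrullDim_quotient_mono hJp₀)
  · have hp₀rad : p₀ = (jetIdeal k (Fin N) m (Set.range F)).radical := by
      rw [← Ideal.radical_minimalPrimes, Ideal.minimalPrimes_eq_subsingleton_self] at hmin
      exact hmin
    refine ringKrullDim_quotient_lt_of_forall_minimalPrimes k _ _ fun q hq => ?_
    have hqp : q.IsPrime := hq.1.1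
    have hpq : p₀ ≤ q := hp₀rad ▸ hqp.radical_le_iff.2 (le_sup_left.trans hq.1.2)
    have hs := ringKrullDim_quotient_succ_le_of_mem_of_notMem hpq
      (hq.1.2 (rename_det_mem_jetOverIdeal m F c)) hg₀
    obtain ⟨s, hs', -⟩ := exists_natCast_eq_ringKrullDim_and_trdeg k
      (C := MvPolynomial (Fin N × Fin (m + 1)) k ⧸ q)
    rw [hdim₀, hs'] at hs
    rw [hs']
    have : s + 1 ≤ n * (m + 1) := by exact_mod_cast hs
    exact_mod_cast Nat.lt_of_succ_le this
  · have huniq : ∀ p ∈ (jetIdeal k (Fin N) m (Set.range F)).minimalPrimes, p = p₀ := by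
      intro p hp
      have hpp : p.IsPrime := hp.1.1
      by_cases h : ∀ c, MvPolynomial.rename (fun i => (i, (0 : Fin (m + 1))))
          (jacobianMinor F c).det ∈ p
      · exact absurd (hge p hp) (not_le.2 ((ringKrullDim_quotient_mono
          (jetOverIdeal_le_of_forall_det_mem hp.1.2 h)).trans_lt hlt))
      · push Not at h
        obtain ⟨c', hc'p⟩ := h
        have hc' : (jacobianMinor F c').det ∉ Ideal.span (Set.range F) :=
          fun h => hc'p (span_le_comap_rename_of_jetIdeal_le hp.1.2 h)
        obtain ⟨p₁, hp₁, hJp₁, hcomap₁, huniv₁, -⟩ :=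
          exists_isPrime_jetIdeal_le hn rfl hdim m hc'
        have h01 : p₀ ≤ p₁ := huniv p₁ hp₁ hJp₁ fun h => hc (hcomap₁ ▸ h)
        have h1 : p₀ ≤ p := h01.trans (huniv₁ p hpp hp.1.2 hc'p)
        exact le_antisymm (hp.2 ⟨hp₀, hJp₀⟩ h1) h1
    rw [← Ideal.sInf_minimalPrimes, Set.eq_singleton_iff_unique_mem.2 ⟨hmin, huniq⟩,
      sInf_singleton]
    exact hp₀
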